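/- arXiv:2104.01919 — 3 statements merged into one kernel-verified Lean document; each statement's English description precedes it below -/
import Mathlib

section
/- Let (T_min, T_min†) be a FAP and B ⊆ ȟ a boundary condition. Denote by C := γ(ker T_max) ⊆ ȟ the Hardy space. Then inclusion and restriction of γ fit into a short exact sequence of vector spaces 0 → ker(T_min) → ker(T_B) → C ∩ B → 0; in particular ker(T_B)/ker(T_min) ≅ C ∩ B as vector spaces. -/
open scoped InnerProductSpace ComplexConjugate
noncomputable section

variable {H₁ H₂ : Type*} [NormedAddCommGroup H₁] [InnerProductSpace ℂ H₁] [CompleteSpace H₁]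
  [NormedAddCommGroup H₂] [InnerProductSpace ℂ H₂] [CompleteSpace H₂]

/-- The domain of a graph submodule `G ⊆ E × F`, i.e. the first-coordinate projection. -/
def domOf {E F : Type*} [AddCommGroup E] [AddCommGroup F] [Module ℂ E] [Module ℂ F]
    (G : Submodule ℂ (E × F)) : Submodule ℂ E := G.map (LinearMap.fst ℂ E F)

/-- The range of (the operator with) graph `G ⊆ E × F`. -/
def ranOf {E F : Type*} [AddCommGroup E] [AddCommGroup F] [Module ℂ E] [Module ℂ F]
    (G : Submodule ℂ (E × F)) : Submodule ℂ F := G.map (LinearMap.snd ℂ E F)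

/-- The kernel of (the operator with) graph `G ⊆ E × F`: those `x` with `(x, 0) ∈ G`. -/
def kerOf {E F : Type*} [AddCommGroup E] [AddCommGroup F] [Module ℂ E] [Module ℂ F]
    (G : Submodule ℂ (E × F)) : Submodule ℂ E := G.comap (LinearMap.inl ℂ E F)

/-- The graph of `T_min` viewed as a submodule of the graph of `T_max := (T_min†)*`
(the latter is identified with `dom T_max` equipped with the graph norm). -/
def minSub (Tmin : H₁ →ₗ.[ℂ] H₂) (Tdag : H₂ →ₗ.[ℂ] H₁) : Submodule ℂ Tdag.adjoint.graph :=
  Submodule.comap Tdag.adjoint.graph.subtype Tmin.graph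

/-- The Cauchy data space `ȟ := dom(T_max)/dom(T_min)` of the FAP `(T_min, T_min†)`,
realised as the quotient of the graph of `T_max = (T_min†)*` by the graph of `T_min`. -/
abbrev HCheck (Tmin : H₁ →ₗ.[ℂ] H₂) (Tdag : H₂ →ₗ.[ℂ] H₁) :=
  Tdag.adjoint.graph ⧸ minSub Tmin Tdag

/-- The graph of the realisation `T_B` determined by a (generalised) boundary condition
`B ⊆ ȟ`, namely `{v ∈ dom T_max : γ v ∈ B}` together with the values of `T_max`. -/
def bGraph (Tmin : H₁ →ₗ.[ℂ] H₂) (Tdag : H₂ →ₗ.[ℂ] H₁)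
    (B : Submodule ℂ (HCheck Tmin Tdag)) : Submodule ℂ (H₁ × H₂) :=
  Submodule.map Tdag.adjoint.graph.subtype (Submodule.comap (minSub Tmin Tdag).mkQ B)

/-- The realisation `T_B` of the FAP determined by the boundary condition `B`. -/
def TB (Tmin : H₁ →ₗ.[ℂ] H₂) (Tdag : H₂ →ₗ.[ℂ] H₁)
    (B : Submodule ℂ (HCheck Tmin Tdag)) : H₁ →ₗ.[ℂ] H₂ :=
  (bGraph Tmin Tdag B).toLinearPMap

/-- The Hardy space `C := γ(ker T_max) ⊆ ȟ`. -/
def hardy (Tmin : H₁ →ₗ.[ℂ] H₂) (Tdag : H₂ →ₗ.[ℂ] H₁) : Submodule ℂ (HCheck Tmin Tdag) :=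
  Submodule.map (minSub Tmin Tdag).mkQ
    (Submodule.comap Tdag.adjoint.graph.subtype (LinearMap.ker (LinearMap.snd ℂ H₁ H₂)))

/-- A pair lies in the graph of `T_B` iff it lies in the graph of `T_max` and its class
in `ȟ` lies in `B`. -/
theorem mem_bGraph_iff {Tmin : H₁ →ₗ.[ℂ] H₂} {Tdag : H₂ →ₗ.[ℂ] H₁}
    {B : Submodule ℂ (HCheck Tmin Tdag)} {p : H₁ × H₂} :
    p ∈ bGraph Tmin Tdag B ↔
      ∃ h : p ∈ Tdag.adjoint.graph, (minSub Tmin Tdag).mkQ ⟨p, h⟩ ∈ B := by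
  simp [bGraph]

/-- The inclusion `x ↦ (x, 0)` of `ker T_B` into the graph of `T_max`. -/
def kerInl (Tmin : H₁ →ₗ.[ℂ] H₂) (Tdag : H₂ →ₗ.[ℂ] H₁) (B : Submodule ℂ (HCheck Tmin Tdag)) :
    kerOf (bGraph Tmin Tdag B) →ₗ[ℂ] Tdag.adjoint.graph :=
  (LinearMap.inl ℂ H₁ H₂ ∘ₗ (kerOf (bGraph Tmin Tdag B)).subtype).codRestrict _
    fun x => (mem_bGraph_iff.1 x.2).1

/-- The restriction of `γ` to a map `ker T_B → C ∩ B`. -/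
def kerTrace (Tmin : H₁ →ₗ.[ℂ] H₂) (Tdag : H₂ →ₗ.[ℂ] H₁) (B : Submodule ℂ (HCheck Tmin Tdag)) :
    kerOf (bGraph Tmin Tdag B) →ₗ[ℂ] ↥(hardy Tmin Tdag ⊓ B) :=
  ((minSub Tmin Tdag).mkQ ∘ₗ kerInl Tmin Tdag B).codRestrict _
    fun x => Submodule.mem_inf.2 ⟨⟨kerInl Tmin Tdag B x, rfl, rfl⟩, (mem_bGraph_iff.1 x.2).2⟩

theorem kerTrace_surjective (Tmin : H₁ →ₗ.[ℂ] H₂) (Tdag : H₂ →ₗ.[ℂ] H₁)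
    (B : Submodule ℂ (HCheck Tmin Tdag)) : Function.Surjective (kerTrace Tmin Tdag B) := by
  rintro ⟨_, ⟨⟨⟨x, y⟩, hxy⟩, hy, rfl⟩, hB⟩
  obtain rfl : y = 0 := hy
  exact ⟨⟨x, mem_bGraph_iff.2 ⟨hxy, hB⟩⟩, rfl⟩

theorem ker_kerTrace (Tmin : H₁ →ₗ.[ℂ] H₂) (Tdag : H₂ →ₗ.[ℂ] H₁)
    (B : Submodule ℂ (HCheck Tmin Tdag)) :
    LinearMap.ker (kerTrace Tmin Tdag B) =
      Submodule.comap (kerOf (bGraph Tmin Tdag B)).subtype (kerOf Tmin.graph) := by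
  rw [kerTrace, LinearMap.ker_codRestrict, LinearMap.ker_comp, Submodule.ker_mkQ]
  rfl

theorem kerOf_graph_le_kerOf_bGraph {Tmin : H₁ →ₗ.[ℂ] H₂} {Tdag : H₂ →ₗ.[ℂ] H₁}
    (h : Tmin ≤ Tdag.adjoint) (B : Submodule ℂ (HCheck Tmin Tdag)) :
    kerOf Tmin.graph ≤ kerOf (bGraph Tmin Tdag B) := by
  intro x hx
  refine mem_bGraph_iff.2 ⟨LinearPMap.le_graph_of_le h hx, ?_⟩
  convert B.zero_mem
  exact (Submodule.Quotient.mk_eq_zero _).2 hx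

/-- Let `(T_min, T_min†)` be a FAP and `B ⊆ ȟ` a boundary condition, with
Hardy space `C := γ(ker T_max)`.  Inclusion and restriction of `γ` fit into a short exact
sequence of vector spaces `0 → ker(T_min) → ker(T_B) → C ∩ B → 0`; in particular
`ker(T_B)/ker(T_min) ≅ C ∩ B` as vector spaces. -/
theorem stmt_8 (Tmin : H₁ →ₗ.[ℂ] H₂) (Tdag : H₂ →ₗ.[ℂ] H₁)
    (hd₁ : Dense (Tmin.domain : Set H₁)) (hd₂ : Dense (Tdag.domain : Set H₂))
    (hc₁ : Tmin.IsClosed) (hc₂ : Tdag.IsClosed)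
    (ha₁ : Tmin ≤ Tdag.adjoint) (ha₂ : Tdag ≤ Tmin.adjoint)
    (B : Submodule ℂ (HCheck Tmin Tdag)) (hB : IsClosed (B : Set (HCheck Tmin Tdag))) :
    -- `ker(T_min) ⊆ ker(T_B)`
    kerOf Tmin.graph ≤ kerOf (bGraph Tmin Tdag B) ∧
    -- the map `ker(T_B) → C ∩ B`, `x ↦ γ(x, 0)`, is surjective with kernel `ker(T_min)`
    (∃ φ : (kerOf (bGraph Tmin Tdag B)) →ₗ[ℂ] ↥(hardy Tmin Tdag ⊓ B),
      (∀ (x : kerOf (bGraph Tmin Tdag B)) (h : ((x : H₁), (0 : H₂)) ∈ Tdag.adjoint.graph),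
        (φ x : HCheck Tmin Tdag) =
          Submodule.Quotient.mk (⟨((x : H₁), (0 : H₂)), h⟩ : Tdag.adjoint.graph)) ∧
      Function.Surjective φ ∧
      LinearMap.ker φ =
        Submodule.comap (kerOf (bGraph Tmin Tdag B)).subtype (kerOf Tmin.graph)) ∧
    -- in particular `ker(T_B)/ker(T_min) ≅ C ∩ B`
    Nonempty ((kerOf (bGraph Tmin Tdag B) ⧸
        Submodule.comap (kerOf (bGraph Tmin Tdag B)).subtype (kerOf Tmin.graph)) ≃ₗ[ℂ]
      ↥(hardy Tmin Tdag ⊓ B)) := by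
  exact ⟨kerOf_graph_le_kerOf_bGraph ha₁ B,
    ⟨kerTrace Tmin Tdag B, fun _ _ => rfl, kerTrace_surjective Tmin Tdag B,
      ker_kerTrace Tmin Tdag B⟩,
    ⟨(Submodule.quotEquivOfEq _ _ (ker_kerTrace Tmin Tdag B).symm).trans
      ((kerTrace Tmin Tdag B).quotKerEquivOfSurjective (kerTrace_surjective Tmin Tdag B))⟩⟩
end
end

section
/- Let (T_min, T_min†) be a Fredholm FAP and B ⊆ ȟ a generalised boundary condition with ran(T_B) closed. Then H₂/ran(T_B) ≅ ker(T_min†) ⊕ (ȟ/(B + C)) as vector spaces, where C is the Hardy space. Consequently the following are equivalent: (i) ran(T_B) has finite algebraic codimension in H₂; (ii) T_B has closed range and ran(T_B)^⊥ is finite dimensional; (iii) B + C has finite algebraic codimension in ȟ; (iv) B + C is closed in ȟ and has finite codimension. -/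
open scoped InnerProductSpace ComplexConjugate
noncomputable section

variable {H₁ H₂ : Type*} [NormedAddCommGroup H₁] [InnerProductSpace ℂ H₁] [CompleteSpace H₁]
  [NormedAddCommGroup H₂] [InnerProductSpace ℂ H₂] [CompleteSpace H₂]

/-- A continuous linear map vanishing on the kernel of a continuous linear surjection
between Banach spaces factors through it. -/
theorem ContinuousLinearMap.exists_comp_eq_of_ker_le {X Y Z : Type*}
    [NormedAddCommGroup X] [NormedSpace ℂ X] [CompleteSpace X]
    [NormedAddCommGroup Y] [NormedSpace ℂ Y] [CompleteSpace Y]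
    [NormedAddCommGroup Z] [NormedSpace ℂ Z]
    (p : X →L[ℂ] Y) (hp : Function.Surjective p) (l : X →L[ℂ] Z)
    (h : ∀ x, p x = 0 → l x = 0) : ∃ L : Y →L[ℂ] Z, ∀ x, L (p x) = l x := by
  have hle : LinearMap.ker (p : X →ₗ[ℂ] Y) ≤ LinearMap.ker (l : X →ₗ[ℂ] Z) := h
  let L₀ : Y →ₗ[ℂ] Z := (LinearMap.ker (p : X →ₗ[ℂ] Y)).liftQ (l : X →ₗ[ℂ] Z) hle ∘ₗ
    ((p : X →ₗ[ℂ] Y).quotKerEquivOfSurjective hp).symm.toLinearMap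
  have hL : ∀ x, L₀ (p x) = l x := by
    intro x
    have : ((p : X →ₗ[ℂ] Y).quotKerEquivOfSurjective hp).symm (p x) =
        Submodule.Quotient.mk x := by
      rw [LinearEquiv.symm_apply_eq]; rfl
    exact congrArg ((LinearMap.ker (p : X →ₗ[ℂ] Y)).liftQ (l : X →ₗ[ℂ] Z) hle) this
  refine ⟨⟨L₀, ?_⟩, hL⟩
  change Continuous L₀
  rw [(p.isQuotientMap hp).continuous_iff]
  exact l.continuous.congr fun x => (hL x).symm

/-- The closed range theorem for graphs: the range of the adjoint of a closed operator with closed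
range is the orthogonal complement of its kernel. -/
theorem ranOf_adjoint_eq_orthogonal_kerOf {E F : Type*}
    [NormedAddCommGroup E] [InnerProductSpace ℂ E] [CompleteSpace E]
    [NormedAddCommGroup F] [InnerProductSpace ℂ F] [CompleteSpace F]
    (g : Submodule ℂ (E × F)) (hg : IsClosed (g : Set (E × F)))
    (hr : IsClosed (ranOf g : Set F)) : ranOf g.adjoint = (kerOf g)ᗮ := by
  ext z
  constructor
  · rintro ⟨⟨x, z⟩, hx, rfl⟩
    rw [Submodule.mem_orthogonal]
    intro a ha
    have := (Submodule.mem_adjoint_iff g (x, z)).1 hx a 0 ha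
    simpa using this
  · intro hz
    have : CompleteSpace g := hg.completeSpace_coe
    have : CompleteSpace (ranOf g) := hr.completeSpace_coe
    let p : g →L[ℂ] ranOf g :=
      ((ContinuousLinearMap.snd ℂ E F).comp g.subtypeL).codRestrict (ranOf g)
        fun w => ⟨w, w.2, rfl⟩
    have hp : Function.Surjective p := by
      rintro ⟨_, w, hw, rfl⟩
      exact ⟨⟨w, hw⟩, rfl⟩
    obtain ⟨L, hL⟩ := p.exists_comp_eq_of_ker_le hp
      ((innerSL ℂ z).comp ((ContinuousLinearMap.fst ℂ E F).comp g.subtypeL)) (by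
        rintro ⟨⟨a, b⟩, hab⟩ h
        obtain rfl : b = 0 := congrArg Subtype.val h
        exact Submodule.inner_left_of_mem_orthogonal (K := kerOf g) hab hz)
    refine ⟨(((InnerProductSpace.toDual ℂ (ranOf g)).symm L : ranOf g), z), ?_, rfl⟩
    refine (Submodule.mem_adjoint_iff g _).2 fun a b hab => ?_
    have h₁ := hL ⟨(a, b), hab⟩
    rw [← InnerProductSpace.toDual_symm_apply, Submodule.coe_inner] at h₁
    change ⟪(((InnerProductSpace.toDual ℂ (ranOf g)).symm L : ranOf g) : F), b⟫_ℂ = ⟪z, a⟫_ℂ at h₁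
    rw [sub_eq_zero, ← inner_conj_symm, h₁, inner_conj_symm]

/-- If `K` is a complement of the range of `f : G → H` and `q : G → Q` is onto with kernel
`N ⊔ ker f`, then `H ⧸ f N` is isomorphic to `K × Q`. -/
theorem nonempty_quotient_map_equiv_prod {G H Q : Type*} [AddCommGroup G] [Module ℂ G]
    [AddCommGroup H] [Module ℂ H] [AddCommGroup Q] [Module ℂ Q]
    (f : G →ₗ[ℂ] H) (N : Submodule ℂ G) (K : Submodule ℂ H) (hK : IsCompl K (LinearMap.range f))
    (q : G →ₗ[ℂ] Q) (hq : Function.Surjective q) (hqk : LinearMap.ker q = N ⊔ LinearMap.ker f) :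
    Nonempty ((H ⧸ N.map f) ≃ₗ[ℂ] K × Q) := by
  let Φ : (K × G) →ₗ[ℂ] H ⧸ N.map f := (N.map f).mkQ ∘ₗ K.subtype.coprod f
  let Ψ : (K × G) →ₗ[ℂ] K × Q := LinearMap.id.prodMap q
  have hΦ : Function.Surjective Φ := by
    refine (Submodule.mkQ_surjective _).comp ?_
    rw [← LinearMap.range_eq_top, LinearMap.range_coprod, Submodule.range_subtype]
    exact hK.sup_eq_top
  have hΨ : Function.Surjective Ψ := Function.surjective_id.prodMap hq
  have hker : LinearMap.ker Φ = LinearMap.ker Ψ := by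
    ext ⟨k, x⟩
    have hx : q x = 0 ↔ f x ∈ N.map f := by
      rw [← LinearMap.mem_ker, hqk, ← Submodule.comap_map_eq, Submodule.mem_comap]
    have hΦk : (k, x) ∈ LinearMap.ker Φ ↔ (k : H) + f x ∈ N.map f := by
      exact LinearMap.mem_ker.trans (Submodule.Quotient.mk_eq_zero _)
    have hΨk : (k, x) ∈ LinearMap.ker Ψ ↔ k = 0 ∧ q x = 0 := by
      simp [Ψ]
    rw [hΦk, hΨk, hx]
    constructor
    · intro h
      have hk : (k : H) ∈ LinearMap.range f := by
        have := sub_mem (LinearMap.map_le_range h) (LinearMap.mem_range_self f x)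
        rwa [add_sub_cancel_right] at this
      have hk0 : (k : H) = 0 := Submodule.disjoint_def.1 hK.disjoint _ k.2 hk
      exact ⟨Subtype.ext hk0, by simpa only [hk0, zero_add] using h⟩
    · rintro ⟨rfl, h⟩
      simpa only [ZeroMemClass.coe_zero, zero_add] using h
  exact ⟨(Φ.quotKerEquivOfSurjective hΦ).symm ≪≫ₗ Submodule.quotEquivOfEq _ _ hker ≪≫ₗ
    Ψ.quotKerEquivOfSurjective hΨ⟩

/-- Let `(T_min, T_min†)` be a Fredholm FAP (closed ranges and finite
dimensional kernels) and `B ⊆ ȟ` a generalised boundary condition with `ran(T_B)` closed.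
Then `H₂/ran(T_B) ≅ ker(T_min†) ⊕ ȟ/(B + C)` as vector spaces (`C` the Hardy space), and
the following are equivalent: (i) `ran(T_B)` has finite algebraic codimension in `H₂`;
(ii) `T_B` has closed range and `ran(T_B)ᗮ` is finite dimensional; (iii) `B + C` has
finite algebraic codimension in `ȟ`; (iv) `B + C` is closed in `ȟ` and has finite
codimension. -/
theorem stmt_13 (Tmin : H₁ →ₗ.[ℂ] H₂) (Tdag : H₂ →ₗ.[ℂ] H₁)
    (hd₁ : Dense (Tmin.domain : Set H₁)) (hd₂ : Dense (Tdag.domain : Set H₂))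
    (hc₁ : Tmin.IsClosed) (hc₂ : Tdag.IsClosed)
    (ha₁ : Tmin ≤ Tdag.adjoint) (ha₂ : Tdag ≤ Tmin.adjoint)
    (hr₁ : IsClosed ((ranOf Tmin.graph : Submodule ℂ H₂) : Set H₂))
    (hr₂ : IsClosed ((ranOf Tdag.graph : Submodule ℂ H₁) : Set H₁))
    (hk₁ : FiniteDimensional ℂ (kerOf Tmin.graph))
    (hk₂ : FiniteDimensional ℂ (kerOf Tdag.graph))
    (B : Submodule ℂ (HCheck Tmin Tdag))
    (hran : IsClosed ((ranOf (bGraph Tmin Tdag B) : Submodule ℂ H₂) : Set H₂)) :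
    Nonempty ((H₂ ⧸ ranOf (bGraph Tmin Tdag B)) ≃ₗ[ℂ]
        (↥(kerOf Tdag.graph) × ((HCheck Tmin Tdag) ⧸ (B ⊔ hardy Tmin Tdag)))) ∧
    List.TFAE
      [ FiniteDimensional ℂ (H₂ ⧸ ranOf (bGraph Tmin Tdag B)),
        IsClosed ((ranOf (bGraph Tmin Tdag B) : Submodule ℂ H₂) : Set H₂) ∧
          FiniteDimensional ℂ ((ranOf (bGraph Tmin Tdag B))ᗮ),
        FiniteDimensional ℂ ((HCheck Tmin Tdag) ⧸ (B ⊔ hardy Tmin Tdag)),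
        IsClosed ((B ⊔ hardy Tmin Tdag : Submodule ℂ (HCheck Tmin Tdag)) :
            Set (HCheck Tmin Tdag)) ∧
          FiniteDimensional ℂ ((HCheck Tmin Tdag) ⧸ (B ⊔ hardy Tmin Tdag)) ] := by
  let f : Tdag.adjoint.graph →ₗ[ℂ] H₂ := LinearMap.snd ℂ H₁ H₂ ∘ₗ Tdag.adjoint.graph.subtype
  let γ := (minSub Tmin Tdag).mkQ
  have hf : Continuous f := continuous_snd.comp continuous_subtype_val
  have hC : hardy Tmin Tdag = (LinearMap.ker f).map γ := rfl
  have hR : ranOf (bGraph Tmin Tdag B) = (B.comap γ).map f := by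
    rw [ranOf, bGraph, ← Submodule.map_comp]
  have hBC : (B ⊔ hardy Tmin Tdag).comap γ = B.comap γ ⊔ LinearMap.ker f := by
    have hγ : Function.Surjective γ := Submodule.mkQ_surjective _
    have hle : LinearMap.ker γ ≤ B.comap γ := LinearMap.ker_le_comap γ
    rw [hC, ← Submodule.map_comap_eq_of_surjective hγ B, ← Submodule.map_sup,
      Submodule.comap_map_eq, Submodule.map_comap_eq_of_surjective hγ B]
    exact sup_eq_left.2 (hle.trans le_sup_left)
  have hcl : IsClosed ((B ⊔ hardy Tmin Tdag : Submodule ℂ (HCheck Tmin Tdag)) :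
      Set (HCheck Tmin Tdag)) := by
    rw [← (minSub Tmin Tdag).isQuotientMap_mkQ.isClosed_preimage]
    have : (B ⊔ hardy Tmin Tdag).comap γ = (ranOf (bGraph Tmin Tdag B)).comap f := by
      rw [hBC, hR, Submodule.comap_map_eq]
    change IsClosed ((B ⊔ hardy Tmin Tdag).comap γ : Set Tdag.adjoint.graph)
    rw [this]
    exact hran.preimage hf
  have hrange : LinearMap.range f = (kerOf Tdag.graph)ᗮ := by
    rw [← ranOf_adjoint_eq_orthogonal_kerOf Tdag.graph hc₂ hr₂,
      ← LinearPMap.adjoint_graph_eq_graph_adjoint hd₂, ranOf, LinearMap.range_comp,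
      Submodule.range_subtype]
  have hequiv : Nonempty ((H₂ ⧸ ranOf (bGraph Tmin Tdag B)) ≃ₗ[ℂ]
      (↥(kerOf Tdag.graph) × ((HCheck Tmin Tdag) ⧸ (B ⊔ hardy Tmin Tdag)))) := by
    rw [hR]
    refine nonempty_quotient_map_equiv_prod f (B.comap γ) (kerOf Tdag.graph)
      (hrange ▸ Submodule.isCompl_orthogonal _) ((B ⊔ hardy Tmin Tdag).mkQ ∘ₗ γ)
      ((Submodule.mkQ_surjective _).comp (Submodule.mkQ_surjective _)) ?_
    rw [LinearMap.ker_comp, Submodule.ker_mkQ, hBC]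
  refine ⟨hequiv, ?_⟩
  obtain ⟨e⟩ := hequiv
  have : CompleteSpace (ranOf (bGraph Tmin Tdag B)) := hran.completeSpace_coe
  have eo := Submodule.quotientEquivOfIsCompl _ _
    (Submodule.isCompl_orthogonal (K := ranOf (bGraph Tmin Tdag B)))
  tfae_have 1 → 2 := fun h => ⟨hran, eo.finiteDimensional⟩
  tfae_have 2 → 1 := fun ⟨_, h⟩ => eo.symm.finiteDimensional
  tfae_have 1 → 3 := fun h => by
    have := e.finiteDimensional
    exact Module.Finite.of_surjective (LinearMap.snd ℂ (kerOf Tdag.graph) _)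
      LinearMap.snd_surjective
  tfae_have 3 → 1 := fun h => e.symm.finiteDimensional
  tfae_have 3 → 4 := fun h => ⟨hcl, h⟩
  tfae_have 4 → 3 := fun h => h.2
  tfae_finish
end
end

section
/- Let (T_min, T_min†) be a Fredholm FAP and B₁ ⊆ B₂ generalised boundary conditions with B₁ a Fredholm boundary condition (i.e. T_{B₁} is Fredholm). Then B₂ is a Fredholm boundary condition if and only if B₂/B₁ is finite dimensional, and in that case ind(T_{B₂}) = ind(T_{B₁}) + dim(B₂/B₁). -/
open scoped InnerProductSpace ComplexConjugate
noncomputable section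

variable {H₁ H₂ : Type*} [NormedAddCommGroup H₁] [InnerProductSpace ℂ H₁] [CompleteSpace H₁]
  [NormedAddCommGroup H₂] [InnerProductSpace ℂ H₂] [CompleteSpace H₂]

/-- `T_B` is a Fredholm operator: it is closed, has finite dimensional kernel, closed
range, and finite dimensional cokernel. -/
def IsFredholmBC (Tmin : H₁ →ₗ.[ℂ] H₂) (Tdag : H₂ →ₗ.[ℂ] H₁)
    (B : Submodule ℂ (HCheck Tmin Tdag)) : Prop :=
  IsClosed ((bGraph Tmin Tdag B : Submodule ℂ (H₁ × H₂)) : Set (H₁ × H₂)) ∧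
  FiniteDimensional ℂ (kerOf (bGraph Tmin Tdag B)) ∧
  IsClosed ((ranOf (bGraph Tmin Tdag B) : Submodule ℂ H₂) : Set H₂) ∧
  FiniteDimensional ℂ (H₂ ⧸ ranOf (bGraph Tmin Tdag B))

/-- The Fredholm index `ind(T_B) = dim ker(T_B) − dim coker(T_B)`. -/
noncomputable def indBC (Tmin : H₁ →ₗ.[ℂ] H₂) (Tdag : H₂ →ₗ.[ℂ] H₁)
    (B : Submodule ℂ (HCheck Tmin Tdag)) : ℤ :=
  (Module.finrank ℂ (kerOf (bGraph Tmin Tdag B)) : ℤ) -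
    (Module.finrank ℂ (H₂ ⧸ ranOf (bGraph Tmin Tdag B)) : ℤ)

section GraphExtension

variable {E F : Type*} [AddCommGroup E] [AddCommGroup F] [Module ℂ E] [Module ℂ F]
  {G₁ G₂ : Submodule ℂ (E × F)}

lemma mem_ranOf {G : Submodule ℂ (E × F)} {y : F} : y ∈ ranOf G ↔ ∃ x, (x, y) ∈ G := by
  simp [ranOf]

lemma mem_kerOf {G : Submodule ℂ (E × F)} {x : E} : x ∈ kerOf G ↔ (x, (0 : F)) ∈ G := by
  simp [kerOf]

lemma ranOf_mono (h : G₁ ≤ G₂) : ranOf G₁ ≤ ranOf G₂ := Submodule.map_mono h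

/-- The map `G₂ ⧸ G₁ → F ⧸ ranOf G₁` induced by the second projection. -/
def quotSnd (G₁ G₂ : Submodule ℂ (E × F)) : (G₂ ⧸ G₁.comap G₂.subtype) →ₗ[ℂ] F ⧸ ranOf G₁ :=
  Submodule.mapQ _ _ (LinearMap.snd ℂ E F ∘ₗ G₂.subtype) fun v hv => ⟨v, hv, rfl⟩

/-- The map `kerOf G₂ → G₂ ⧸ G₁` induced by `x ↦ (x, 0)`. -/
def kerToQuot (G₁ G₂ : Submodule ℂ (E × F)) : kerOf G₂ →ₗ[ℂ] G₂ ⧸ G₁.comap G₂.subtype :=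
  (G₁.comap G₂.subtype).mkQ ∘ₗ (LinearMap.inl ℂ E F).restrict (q := G₂) fun _ hx => hx

lemma range_quotSnd : LinearMap.range (quotSnd G₁ G₂) = (ranOf G₂).map (ranOf G₁).mkQ := by
  ext y
  constructor
  · rintro ⟨v, rfl⟩
    obtain ⟨v, rfl⟩ := Submodule.mkQ_surjective _ v
    exact ⟨v.1.2, ⟨v.1, v.2, rfl⟩, rfl⟩
  · rintro ⟨_, ⟨v, hv, rfl⟩, rfl⟩
    exact ⟨Submodule.mkQ _ ⟨v, hv⟩, rfl⟩

lemma range_kerToQuot (h : G₁ ≤ G₂) :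
    LinearMap.range (kerToQuot G₁ G₂) = LinearMap.ker (quotSnd G₁ G₂) := by
  ext v
  constructor
  · rintro ⟨x, rfl⟩
    exact (Submodule.Quotient.mk_eq_zero _).2 (zero_mem _)
  · obtain ⟨⟨⟨x, y⟩, hv⟩, rfl⟩ := Submodule.mkQ_surjective _ v
    intro hy
    obtain ⟨x', hx'⟩ := mem_ranOf.1 ((Submodule.Quotient.mk_eq_zero (ranOf G₁) (x := y)).1 hy)
    have hmem : (x - x', (0 : F)) ∈ G₂ := by simpa using sub_mem hv (h hx')
    refine ⟨⟨x - x', hmem⟩, (Submodule.Quotient.eq _).2 ?_⟩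
    change (x - x', (0 : F)) - (x, y) ∈ G₁
    simpa using neg_mem hx'

lemma ker_kerToQuot : LinearMap.ker (kerToQuot G₁ G₂) = (kerOf G₁).comap (kerOf G₂).subtype := by
  ext x
  exact Submodule.Quotient.mk_eq_zero _

/-- The kernel of `kerToQuot` is the smaller kernel. -/
def kerKerToQuotEquiv (h : G₁ ≤ G₂) : LinearMap.ker (kerToQuot G₁ G₂) ≃ₗ[ℂ] kerOf G₁ :=
  LinearEquiv.ofEq _ _ ker_kerToQuot ≪≫ₗ
    Submodule.comapSubtypeEquivOfLe (Submodule.comap_mono h : kerOf G₁ ≤ kerOf G₂)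

lemma finiteDimensional_quotient_iff (h : G₁ ≤ G₂) [FiniteDimensional ℂ (kerOf G₁)]
    [FiniteDimensional ℂ (F ⧸ ranOf G₁)] :
    FiniteDimensional ℂ (G₂ ⧸ G₁.comap G₂.subtype) ↔ FiniteDimensional ℂ (kerOf G₂) := by
  have := (kerKerToQuotEquiv h).symm.finiteDimensional
  constructor <;> intro _
  · have := (kerToQuot G₁ G₂).quotKerEquivRange.symm.finiteDimensional
    exact Module.Finite.of_submodule_quotient (LinearMap.ker (kerToQuot G₁ G₂))
  · have : FiniteDimensional ℂ (LinearMap.ker (quotSnd G₁ G₂)) := by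
      rw [← range_kerToQuot h]; infer_instance
    have := (quotSnd G₁ G₂).quotKerEquivRange.symm.finiteDimensional
    exact Module.Finite.of_submodule_quotient (LinearMap.ker (quotSnd G₁ G₂))

lemma index_eq_add_finrank_quotient (h : G₁ ≤ G₂) [FiniteDimensional ℂ (kerOf G₂)]
    [FiniteDimensional ℂ (F ⧸ ranOf G₁)] [FiniteDimensional ℂ (G₂ ⧸ G₁.comap G₂.subtype)] :
    (Module.finrank ℂ (kerOf G₂) : ℤ) - Module.finrank ℂ (F ⧸ ranOf G₂) =
      Module.finrank ℂ (kerOf G₁) - Module.finrank ℂ (F ⧸ ranOf G₁) +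
        Module.finrank ℂ (G₂ ⧸ G₁.comap G₂.subtype) := by
  have hker := (kerToQuot G₁ G₂).finrank_range_add_finrank_ker
  have hquot := (quotSnd G₁ G₂).finrank_range_add_finrank_ker
  have hran := ((ranOf G₂).map (ranOf G₁).mkQ).finrank_quotient_add_finrank
  rw [(Submodule.quotientQuotientEquivQuotient _ _ (ranOf_mono h)).finrank_eq] at hran
  rw [range_kerToQuot h, (kerKerToQuotEquiv h).finrank_eq] at hker
  rw [range_quotSnd] at hquot
  omega

end GraphExtension

lemma Submodule.isClosed_of_le_of_finiteDimensional_quotient {E : Type*} [NormedAddCommGroup E]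
    [NormedSpace ℂ E] {S S' : Submodule ℂ E} (h : S ≤ S') (hS : IsClosed (S : Set E))
    [FiniteDimensional ℂ (S'.map S.mkQ)] : IsClosed (S' : Set E) := by
  have : IsClosed (S : Set E) := hS
  have hcl := (S'.map S.mkQ).closed_of_finiteDimensional
  have hpre : IsClosed ((S'.map S.mkQ).comap S.mkQ : Set E) := hcl.preimage continuous_quot_mk
  rwa [Submodule.comap_map_mkQ, sup_eq_right.2 h] at hpre

section BoundaryCondition

variable {Tmin : H₁ →ₗ.[ℂ] H₂} {Tdag : H₂ →ₗ.[ℂ] H₁} {B₁ B₂ : Submodule ℂ (HCheck Tmin Tdag)}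

lemma bGraph_mono (h : B₁ ≤ B₂) : bGraph Tmin Tdag B₁ ≤ bGraph Tmin Tdag B₂ :=
  Submodule.map_mono (Submodule.comap_mono h)

lemma coe_mem_bGraph {B : Submodule ℂ (HCheck Tmin Tdag)} {v : Tdag.adjoint.graph} :
    (v : H₁ × H₂) ∈ bGraph Tmin Tdag B ↔ (minSub Tmin Tdag).mkQ v ∈ B := by
  simp [bGraph]

lemma bGraph_le_graph (B : Submodule ℂ (HCheck Tmin Tdag)) :
    bGraph Tmin Tdag B ≤ Tdag.adjoint.graph :=
  Submodule.map_subtype_le _ _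

/-- The trace map from the graph of a realisation to its boundary condition. -/
def bTrace (B : Submodule ℂ (HCheck Tmin Tdag)) : bGraph Tmin Tdag B →ₗ[ℂ] B :=
  ((minSub Tmin Tdag).mkQ ∘ₗ Submodule.inclusion (bGraph_le_graph B)).codRestrict B
    fun v => coe_mem_bGraph.1 v.2

lemma bTrace_surjective (B : Submodule ℂ (HCheck Tmin Tdag)) :
    Function.Surjective (bTrace B) := by
  rintro ⟨b, hb⟩
  obtain ⟨v, rfl⟩ := Submodule.mkQ_surjective _ b
  exact ⟨⟨v, coe_mem_bGraph.2 hb⟩, rfl⟩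

/-- The trace map identifies the quotient of the graphs of two realisations with the quotient of
their boundary conditions. -/
def bGraphQuotEquiv (B₁ B₂ : Submodule ℂ (HCheck Tmin Tdag)) :
    ((bGraph Tmin Tdag B₂) ⧸ (bGraph Tmin Tdag B₁).comap (bGraph Tmin Tdag B₂).subtype) ≃ₗ[ℂ]
      B₂ ⧸ B₁.comap B₂.subtype :=
  Submodule.quotEquivOfEq _ (LinearMap.ker ((B₁.comap B₂.subtype).mkQ ∘ₗ bTrace B₂)) (by
      ext v
      rw [LinearMap.ker_comp, Submodule.ker_mkQ]
      exact coe_mem_bGraph (v := Submodule.inclusion (bGraph_le_graph B₂) v)) ≪≫ₗ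
    LinearMap.quotKerEquivOfSurjective _
      ((Submodule.mkQ_surjective _).comp (bTrace_surjective B₂))

end BoundaryCondition

/-- Let `(T_min, T_min†)` be a Fredholm FAP and `B₁ ⊆ B₂` generalised
boundary conditions with `B₁` a Fredholm boundary condition (i.e. `T_{B₁}` Fredholm).
Then `B₂` is a Fredholm boundary condition iff `B₂/B₁` is finite dimensional, and in that
case `ind(T_{B₂}) = ind(T_{B₁}) + dim(B₂/B₁)`. -/
theorem stmt_15 (Tmin : H₁ →ₗ.[ℂ] H₂) (Tdag : H₂ →ₗ.[ℂ] H₁)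
    (hd₁ : Dense (Tmin.domain : Set H₁)) (hd₂ : Dense (Tdag.domain : Set H₂))
    (hc₁ : Tmin.IsClosed) (hc₂ : Tdag.IsClosed)
    (ha₁ : Tmin ≤ Tdag.adjoint) (ha₂ : Tdag ≤ Tmin.adjoint)
    (hr₁ : IsClosed ((ranOf Tmin.graph : Submodule ℂ H₂) : Set H₂))
    (hr₂ : IsClosed ((ranOf Tdag.graph : Submodule ℂ H₁) : Set H₁))
    (hk₁ : FiniteDimensional ℂ (kerOf Tmin.graph))
    (hk₂ : FiniteDimensional ℂ (kerOf Tdag.graph))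
    (B₁ B₂ : Submodule ℂ (HCheck Tmin Tdag)) (h12 : B₁ ≤ B₂)
    (hB₁ : IsFredholmBC Tmin Tdag B₁) :
    (IsFredholmBC Tmin Tdag B₂ ↔
      FiniteDimensional ℂ (B₂ ⧸ Submodule.comap B₂.subtype B₁)) ∧
    (IsFredholmBC Tmin Tdag B₂ →
      indBC Tmin Tdag B₂ =
        indBC Tmin Tdag B₁ +
          (Module.finrank ℂ (B₂ ⧸ Submodule.comap B₂.subtype B₁) : ℤ)) := by
  obtain ⟨hG₁, hker₁, hR₁, hcoker₁⟩ := hB₁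
  have hG := bGraph_mono h12
  have hiff := finiteDimensional_quotient_iff hG
  have e := bGraphQuotEquiv B₁ B₂
  have hfd : IsFredholmBC Tmin Tdag B₂ ↔ FiniteDimensional ℂ (B₂ ⧸ B₁.comap B₂.subtype) := by
    constructor
    · rintro ⟨-, hker₂, -, -⟩
      have := hiff.2 hker₂
      exact e.finiteDimensional
    · intro _
      have hquot := e.symm.finiteDimensional
      have : FiniteDimensional ℂ
          ((bGraph Tmin Tdag B₂).map (bGraph Tmin Tdag B₁).mkQ) := by
        rw [← Submodule.range_subtype (bGraph Tmin Tdag B₂), ← LinearMap.range_comp,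
          ← Submodule.range_liftQ ((bGraph Tmin Tdag B₁).comap (bGraph Tmin Tdag B₂).subtype) _
            (by rw [LinearMap.ker_comp, Submodule.ker_mkQ])]
        infer_instance
      exact ⟨Submodule.isClosed_of_le_of_finiteDimensional_quotient hG hG₁, hiff.1 hquot,
        Submodule.isClosed_of_le_of_finiteDimensional_quotient (ranOf_mono hG) hR₁,
        Module.Finite.of_surjective _ (Submodule.factor_surjective (ranOf_mono hG))⟩
  refine ⟨hfd, fun hB₂ => ?_⟩
  have := hB₂.2.1
  have := hiff.2 this
  rw [← e.finrank_eq]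
  exact index_eq_add_finrank_quotient hG
end
end
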